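/- arXiv:2311.15953 — 3 statements merged into one kernel-verified Lean document; each statement's English description precedes it below -/
import Mathlib

section
/- Let G = (V, E) be a finite simple graph with nonempty vertex set, and consider the set system (V, I) where I is the family of all independent sets of G. Then p_U(V, I) = p_R(V, I) = 1 / χ_f(G), where χ_f(G) is the fractional vertex coloring number of G. -/
open Finset

/-- Uniform fairness value `p_U` of a set system `(A, M)`. -/
noncomputable def pU {α : Type*} [DecidableEq α] (A : Finset α) (M : Finset (Finset α)) : ℝ :=
  sSup {p : ℝ | ∃ x : Finset α → ℝ, (∀ m ∈ M, 0 ≤ x m) ∧ (∑ m ∈ M, x m) = 1 ∧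
    ∀ a ∈ A, (∑ m ∈ M.filter (fun m => a ∈ m), x m) = p}

/-- Rawlsian justice value `p_R` of a set system `(A, M)`. -/
noncomputable def pR {α : Type*} [DecidableEq α] (A : Finset α) (M : Finset (Finset α)) : ℝ :=
  sSup {p : ℝ | ∃ x : Finset α → ℝ, (∀ m ∈ M, 0 ≤ x m) ∧ (∑ m ∈ M, x m) = 1 ∧
    ∀ a ∈ A, p ≤ (∑ m ∈ M.filter (fun m => a ∈ m), x m)}

/-- Fractional partitioning number `k_f^=` of the hypergraph `(A, M)`. -/
noncomputable def fracPartNum {α : Type*} [DecidableEq α] (A : Finset α) (M : Finset (Finset α)) : ℝ :=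
  sInf {s : ℝ | ∃ w : Finset α → ℝ, (∀ m ∈ M, 0 ≤ w m) ∧
    (∀ a ∈ A, (∑ m ∈ M.filter (fun m => a ∈ m), w m) = 1) ∧ s = ∑ m ∈ M, w m}

/-- Fractional covering number `k_f^≥` of the hypergraph `(A, M)`. -/
noncomputable def fracCovNum {α : Type*} [DecidableEq α] (A : Finset α) (M : Finset (Finset α)) : ℝ :=
  sInf {s : ℝ | ∃ w : Finset α → ℝ, (∀ m ∈ M, 0 ≤ w m) ∧
    (∀ a ∈ A, 1 ≤ (∑ m ∈ M.filter (fun m => a ∈ m), w m)) ∧ s = ∑ m ∈ M, w m}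

/-- The family of all independent sets of `G`. -/
noncomputable def indepSets {V : Type*} [Fintype V] [DecidableEq V]
    (G : SimpleGraph V) [DecidableRel G.Adj] : Finset (Finset V) :=
  Finset.univ.powerset.filter (fun s => ∀ u ∈ s, ∀ v ∈ s, u ≠ v → ¬ G.Adj u v)

/-- The fractional vertex coloring number `χ_f(G)`: the fractional covering number of
the hypergraph of independent sets of `G`. -/
noncomputable def fracChromaticNumber {V : Type*} [Fintype V] [DecidableEq V]
    (G : SimpleGraph V) [DecidableRel G.Adj] : ℝ :=
  fracCovNum Finset.univ (indepSets G)

/-- Weight of `T` when each element `a` of `S` is kept independently with probability `θ a`. -/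
noncomputable def thinWeight {α : Type*} [DecidableEq α] (θ : α → ℝ) (S T : Finset α) : ℝ :=
  (∏ a ∈ T, θ a) * ∏ a ∈ S \ T, (1 - θ a)

theorem sum_powerset_thinWeight {α : Type*} [DecidableEq α] (θ : α → ℝ) (S : Finset α) :
    ∑ T ∈ S.powerset, thinWeight θ S T = 1 := by
  simp only [thinWeight]
  rw [← Finset.prod_add]
  simp

theorem sum_powerset_filter_mem_thinWeight {α : Type*} [DecidableEq α] (θ : α → ℝ)
    (S : Finset α) (a : α) :
    ∑ T ∈ S.powerset with a ∈ T, thinWeight θ S T = if a ∈ S then θ a else 0 := by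
  split_ifs with ha
  · have h := Finset.prod_add θ (fun b => if b = a then 0 else 1 - θ b) S
    have h_prod : ∏ b ∈ S, (θ b + if b = a then 0 else 1 - θ b) = θ a := by
      rw [Finset.prod_eq_single_of_mem a ha]
      · simp
      · intro b _ hb
        simp [hb]
    rw [← h_prod, h, Finset.sum_filter]
    refine Finset.sum_congr rfl fun T _ => ?_
    split_ifs with haT
    · rw [thinWeight]
      congr 1
      refine Finset.prod_congr rfl fun b hb => ?_
      have hne : b ≠ a := by
        rintro rfl
        exact (Finset.mem_sdiff.1 hb).2 haT
      simp [hne]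
    · rw [Finset.prod_eq_zero (i := a) (s := S \ T) (Finset.mem_sdiff.2 ⟨ha, haT⟩) (by simp),
        mul_zero]
  · refine Finset.sum_eq_zero fun T hT => ?_
    rw [Finset.mem_filter, Finset.mem_powerset] at hT
    exact absurd (hT.1 hT.2) ha

/-- In a downward closed family, a fractional cover can be thinned to a fractional partition
of the same total weight. -/
theorem exists_fracPartition_of_fracCover {α : Type*} [DecidableEq α] {A : Finset α}
    {M : Finset (Finset α)} (hM : ∀ S ∈ M, ∀ T, T ⊆ S → T ∈ M) (hA : ∀ S ∈ M, S ⊆ A)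
    {w : Finset α → ℝ}
    (hw : ∀ m ∈ M, 0 ≤ w m) (hc : ∀ a ∈ A, 1 ≤ ∑ m ∈ M with a ∈ m, w m) :
    ∃ w' : Finset α → ℝ, (∀ m ∈ M, 0 ≤ w' m) ∧
      (∀ a ∈ A, ∑ m ∈ M with a ∈ m, w' m = 1) ∧ ∑ m ∈ M, w' m = ∑ m ∈ M, w m := by
  set θ : α → ℝ := fun a => (∑ m ∈ M with a ∈ m, w m)⁻¹ with hθ
  have h_pow : ∀ S ∈ M, M.filter (· ⊆ S) = S.powerset := by
    intro S hS
    ext T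
    simp only [Finset.mem_filter, Finset.mem_powerset]
    exact ⟨fun h => h.2, fun h => ⟨hM S hS T h, h⟩⟩
  refine ⟨fun T => ∑ S ∈ M, if T ⊆ S then w S * thinWeight θ S T else 0, ?_, ?_, ?_⟩
  · intro T _
    refine Finset.sum_nonneg fun S hS => ?_
    split_ifs with hTS
    · refine mul_nonneg (hw S hS) (mul_nonneg (Finset.prod_nonneg fun a ha => ?_)
        (Finset.prod_nonneg fun a ha => ?_))
      · exact inv_nonneg.2 (zero_le_one.trans (hc a (hA S hS (hTS ha))))
      · exact sub_nonneg.2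
          (inv_le_one_of_one_le₀ (hc a (hA S hS (Finset.mem_sdiff.1 ha).1)))
    · exact le_rfl
  · intro a ha
    rw [Finset.sum_comm]
    have h_inner : ∀ S ∈ M, (∑ T ∈ M with a ∈ T, if T ⊆ S then w S * thinWeight θ S T else 0)
        = if a ∈ S then w S * θ a else 0 := by
      intro S hS
      rw [← Finset.sum_filter, Finset.filter_comm, h_pow S hS, ← Finset.mul_sum,
        sum_powerset_filter_mem_thinWeight, mul_ite, mul_zero]
    rw [Finset.sum_congr rfl h_inner, ← Finset.sum_filter, ← Finset.sum_mul]
    exact mul_inv_cancel₀ (zero_lt_one.trans_le (hc a ha)).ne'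
  · rw [Finset.sum_comm]
    refine Finset.sum_congr rfl fun S hS => ?_
    rw [← Finset.sum_filter, h_pow S hS, ← Finset.mul_sum, sum_powerset_thinWeight, mul_one]

/-- For a downward closed family covering a nonempty ground set, the uniform fairness and
Rawlsian justice values are the inverse of the fractional covering number. -/
theorem pU_eq_pR_eq_inv_fracCovNum {α : Type*} [DecidableEq α] {A : Finset α}
    {M : Finset (Finset α)} (hne : A.Nonempty) (hM : ∀ S ∈ M, ∀ T, T ⊆ S → T ∈ M)
    (hA : ∀ S ∈ M, S ⊆ A) (h_single : ∀ a ∈ A, {a} ∈ M) :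
    pU A M = 1 / fracCovNum A M ∧ pR A M = 1 / fracCovNum A M := by
  obtain ⟨a₀, ha₀⟩ := hne
  have h_sum_le : ∀ x : Finset α → ℝ, (∀ m ∈ M, 0 ≤ x m) →
      ∑ m ∈ M with a₀ ∈ m, x m ≤ ∑ m ∈ M, x m := fun x hx =>
    Finset.sum_le_sum_of_subset_of_nonneg (Finset.filter_subset _ _) fun m hm _ => hx m hm
  set C : Set ℝ := {s : ℝ | ∃ w : Finset α → ℝ, (∀ m ∈ M, 0 ≤ w m) ∧
    (∀ a ∈ A, 1 ≤ (∑ m ∈ M.filter (fun m => a ∈ m), w m)) ∧ s = ∑ m ∈ M, w m} with hC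
  set U : Set ℝ := {p : ℝ | ∃ x : Finset α → ℝ, (∀ m ∈ M, 0 ≤ x m) ∧ (∑ m ∈ M, x m) = 1 ∧
    ∀ a ∈ A, (∑ m ∈ M.filter (fun m => a ∈ m), x m) = p} with hU
  set R : Set ℝ := {p : ℝ | ∃ x : Finset α → ℝ, (∀ m ∈ M, 0 ≤ x m) ∧ (∑ m ∈ M, x m) = 1 ∧
    ∀ a ∈ A, p ≤ (∑ m ∈ M.filter (fun m => a ∈ m), x m)} with hR
  change sSup U = 1 / sInf C ∧ sSup R = 1 / sInf C
  have hC_ne : C.Nonempty := by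
    refine ⟨_, fun _ => 1, fun _ _ => zero_le_one, fun a ha => ?_, rfl⟩
    exact Finset.single_le_sum (f := fun _ => (1 : ℝ)) (fun _ _ => zero_le_one)
      (Finset.mem_filter.2 ⟨h_single a ha, Finset.mem_singleton_self a⟩)
  have hC_one : ∀ s ∈ C, 1 ≤ s := by
    rintro s ⟨w, hw, hc, rfl⟩
    exact (hc a₀ ha₀).trans (h_sum_le w hw)
  have hC_bdd : BddBelow C := ⟨1, hC_one⟩
  have hC_pos : 0 < sInf C := zero_lt_one.trans_le (le_csInf hC_ne hC_one)
  have hUR : U ⊆ R := by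
    rintro p ⟨x, hx, hx1, hp⟩
    exact ⟨x, hx, hx1, fun a ha => (hp a ha).ge⟩
  have hR_le : ∀ p ∈ R, p ≤ 1 / sInf C := by
    rintro p ⟨x, hx, hx1, hp⟩
    rcases le_or_gt p 0 with h0 | h0
    · exact h0.trans (by positivity)
    · rw [le_one_div h0 hC_pos]
      refine csInf_le hC_bdd ⟨fun m => x m / p, fun m hm => div_nonneg (hx m hm) h0.le,
        fun a ha => ?_, ?_⟩
      · rw [← Finset.sum_div, one_le_div h0]
        exact hp a ha
      · rw [← Finset.sum_div, hx1]
  have hR_bdd : BddAbove R := ⟨_, hR_le⟩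
  have hU_bdd : BddAbove U := hR_bdd.mono hUR
  have hCU : ∀ s ∈ C, 1 / s ∈ U := by
    intro s hs
    have hs_pos : 0 < s := zero_lt_one.trans_le (hC_one s hs)
    obtain ⟨w, hw, hc, rfl⟩ := hs
    obtain ⟨w', hw', hp, h_total⟩ := exists_fracPartition_of_fracCover hM hA hw hc
    refine ⟨fun m => w' m / ∑ m ∈ M, w m, fun m hm => div_nonneg (hw' m hm) hs_pos.le, ?_, ?_⟩
    · rw [← Finset.sum_div, h_total, div_self hs_pos.ne']
    · intro a ha
      rw [← Finset.sum_div, hp a ha]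
  have hU_ne : U.Nonempty := hC_ne.elim fun s hs => ⟨_, hCU s hs⟩
  have h_pos : 0 < sSup U := by
    obtain ⟨s, hs⟩ := hC_ne
    exact (one_div_pos.2 (zero_lt_one.trans_le (hC_one s hs))).trans_le
      (le_csSup hU_bdd (hCU s hs))
  have h_lower : 1 / sInf C ≤ sSup U := by
    rw [one_div_le hC_pos h_pos]
    refine le_csInf hC_ne fun s hs => ?_
    rw [one_div_le h_pos (zero_lt_one.trans_le (hC_one s hs))]
    exact le_csSup hU_bdd (hCU s hs)
  have h_mid : sSup U ≤ sSup R := csSup_le_csSup hR_bdd hU_ne hUR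
  have h_upper : sSup R ≤ 1 / sInf C := csSup_le (hU_ne.mono hUR) hR_le
  exact ⟨le_antisymm (h_mid.trans h_upper) h_lower,
    le_antisymm h_upper (h_lower.trans h_mid)⟩

/-- For a graph `G` on a nonempty vertex set, the uniform fairness and Rawlsian
justice values of the fair independent set system both equal `1 / χ_f(G)`. -/
theorem fairIndepSet_pU_eq_pR_eq_inv_fracChromatic
    {V : Type*} [Fintype V] [DecidableEq V] [Nonempty V]
    (G : SimpleGraph V) [DecidableRel G.Adj] :
    pU Finset.univ (indepSets G) = 1 / fracChromaticNumber G ∧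
    pR Finset.univ (indepSets G) = 1 / fracChromaticNumber G := by
  refine pU_eq_pR_eq_inv_fracCovNum Finset.univ_nonempty ?_ (fun S _ => Finset.subset_univ S) ?_
  · intro S hS T hTS
    simp only [indepSets, Finset.powerset_univ, Finset.mem_filter, Finset.mem_univ,
      true_and] at hS ⊢
    exact fun u hu v hv => hS u (hTS hu) v (hTS hv)
  · intro a _
    simp [indepSets]
end

section
/- Let G = (V, E) be a finite simple graph with no isolated vertices, and consider the set system (V, V(M)) where V(M) is the family of vertex sets covered by matchings of G. Then the set {(x, p) ∈ ℝ^E × ℝ : x_e ≥ 0 for all e ∈ E, p ≥ 0, ∑_{e ∈ δ(v)} x_e = p for all v ∈ V, and ∑_{e ∈ E} x_e = 1} is nonempty if and only if p_U(V, V(M)) > 0. -/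
open Finset

/-- The family of all matchings of `G`, as finsets of edges. -/
noncomputable def matchings {V : Type*} [Fintype V] [DecidableEq V]
    (G : SimpleGraph V) [DecidableRel G.Adj] : Finset (Finset (Sym2 V)) :=
  G.edgeFinset.powerset.filter
    (fun s => ∀ e ∈ s, ∀ f ∈ s, e ≠ f → ∀ v : V, ¬(v ∈ e ∧ v ∈ f))

/-- The family `V(M)` of vertex sets covered by matchings of `G`. -/
noncomputable def coveredSets {V : Type*} [Fintype V] [DecidableEq V]
    (G : SimpleGraph V) [DecidableRel G.Adj] : Finset (Finset V) :=
  (matchings G).image (fun m => Finset.univ.filter (fun v => ∃ e ∈ m, v ∈ e))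

theorem mem_matchings {V : Type*} [Fintype V] [DecidableEq V]
    (G : SimpleGraph V) [DecidableRel G.Adj] {m : Finset (Sym2 V)} :
    m ∈ matchings G ↔ m ⊆ G.edgeFinset ∧
      ∀ e ∈ m, ∀ f ∈ m, e ≠ f → ∀ v : V, ¬(v ∈ e ∧ v ∈ f) := by
  simp [matchings]

theorem filter_mem_edge_mem_coveredSets {V : Type*} [Fintype V] [DecidableEq V]
    (G : SimpleGraph V) [DecidableRel G.Adj] {e : Sym2 V} (he : e ∈ G.edgeFinset) :
    univ.filter (fun v => v ∈ e) ∈ coveredSets G := by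
  refine mem_image.2 ⟨{e}, (mem_matchings G).2 ⟨by simpa using he, ?_⟩, by simp⟩
  intro a ha b hb hab
  rw [mem_singleton] at ha hb
  exact absurd (ha.trans hb.symm) hab

/-- Over a nonempty ground set, the supremum defining `pU` is positive exactly when it has a
positive competitor. -/
theorem pU_pos_iff {α : Type*} [DecidableEq α] {A : Finset α} (hA : A.Nonempty)
    (M : Finset (Finset α)) :
    0 < pU A M ↔ ∃ p : ℝ, 0 < p ∧ ∃ x : Finset α → ℝ, (∀ m ∈ M, 0 ≤ x m) ∧
      (∑ m ∈ M, x m) = 1 ∧ ∀ a ∈ A, (∑ m ∈ M.filter (fun m => a ∈ m), x m) = p := by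
  constructor
  · intro h
    by_contra! hne
    refine h.not_ge (Real.sSup_nonpos ?_)
    rintro p ⟨x, hx, hsum, hp⟩
    by_contra! hpos
    obtain ⟨a, ha, hap⟩ := hne p hpos x hx hsum
    exact hap (hp a ha)
  · rintro ⟨p, hp, hx⟩
    refine hp.trans_le (le_csSup ⟨1, ?_⟩ hx)
    rintro q ⟨y, hy, hsum, hq⟩
    obtain ⟨a, ha⟩ := hA
    rw [← hq a ha, ← hsum]
    exact sum_le_sum_of_subset_of_nonneg (filter_subset _ _) fun m hm _ => hy m hm

/-- Moving the weight of every edge to its pair of endpoints. -/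
theorem exists_vertexWeights_of_edgeWeights {V : Type*} [Fintype V] [DecidableEq V]
    (G : SimpleGraph V) [DecidableRel G.Adj] (x : Sym2 V → ℝ)
    (hx : ∀ e ∈ G.edgeFinset, 0 ≤ x e) :
    ∃ y : Finset V → ℝ, (∀ S ∈ coveredSets G, 0 ≤ y S) ∧
      (∑ S ∈ coveredSets G, y S = ∑ e ∈ G.edgeFinset, x e) ∧
      ∀ v : V, ∑ S ∈ (coveredSets G).filter (fun S => v ∈ S), y S =
        ∑ e ∈ G.edgeFinset.filter (fun e => v ∈ e), x e := by
  have hmaps : ∀ e ∈ G.edgeFinset, univ.filter (fun v => v ∈ e) ∈ coveredSets G :=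
    fun e he => filter_mem_edge_mem_coveredSets G he
  refine ⟨fun S => ∑ e ∈ G.edgeFinset.filter (fun e => univ.filter (fun v => v ∈ e) = S), x e,
    fun S _ => sum_nonneg fun e he => hx e (mem_filter.1 he).1,
    sum_fiberwise_of_maps_to hmaps x, fun v => ?_⟩
  rw [sum_filter, sum_filter, ← sum_fiberwise_of_maps_to hmaps]
  refine sum_congr rfl fun S _ => ?_
  have key : ∀ e ∈ G.edgeFinset.filter (fun e => univ.filter (fun v => v ∈ e) = S),
      (if v ∈ e then x e else 0) = if v ∈ S then x e else 0 := by
    intro e he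
    rw [← (mem_filter.1 he).2]
    simp
  rw [sum_congr rfl key]
  split_ifs <;> simp

/-- Distributing the weight of every covered set over a matching covering it. -/
theorem exists_edgeWeights_of_vertexWeights {V : Type*} [Fintype V] [DecidableEq V]
    (G : SimpleGraph V) [DecidableRel G.Adj] (y : Finset V → ℝ)
    (hy : ∀ S ∈ coveredSets G, 0 ≤ y S) :
    ∃ x : Sym2 V → ℝ, (∀ e, 0 ≤ x e) ∧
      ∀ v : V, ∑ e ∈ G.edgeFinset.filter (fun e => v ∈ e), x e =
        ∑ S ∈ (coveredSets G).filter (fun S => v ∈ S), y S := by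
  have hcov : ∀ S : Finset V, ∃ m : Finset (Sym2 V), S ∈ coveredSets G →
      m ∈ matchings G ∧ univ.filter (fun v => ∃ e ∈ m, v ∈ e) = S := by
    intro S
    by_cases hS : S ∈ coveredSets G
    · obtain ⟨m, hm⟩ := mem_image.1 hS
      exact ⟨m, fun _ => hm⟩
    · exact ⟨∅, fun h => absurd h hS⟩
  choose m hm using hcov
  refine ⟨fun e => ∑ S ∈ coveredSets G, if e ∈ m S then y S else 0,
    fun e => sum_nonneg fun S hS => ?_, fun v => ?_⟩
  · split_ifs
    exacts [hy S hS, le_rfl]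
  rw [sum_comm, sum_filter]
  refine sum_congr rfl fun S hS => ?_
  obtain ⟨hmS, hVS⟩ := hm S hS
  obtain ⟨hsub, hdisj⟩ := (mem_matchings G).1 hmS
  have hmem : v ∈ S ↔ ∃ e ∈ m S, v ∈ e := by
    conv_lhs => rw [← hVS]
    simp
  split_ifs with hv
  · obtain ⟨e, he, hve⟩ := hmem.1 hv
    rw [sum_eq_single_of_mem e (mem_filter.2 ⟨hsub he, hve⟩), if_pos he]
    intro f hf hfe
    exact if_neg fun hfm => hdisj f hfm e he hfe v ⟨(mem_filter.1 hf).2, hve⟩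
  · refine sum_eq_zero fun e he => if_neg fun hem => hv (hmem.2 ⟨e, hem, (mem_filter.1 he).2⟩)

/-- For a graph `G` without isolated vertices, the set
`{(x, p) : x ≥ 0, p ≥ 0, ∑_{e ∈ δ(v)} x_e = p for all v, ∑_e x_e = 1}` is nonempty
if and only if the uniform fairness value of the fair matching for vertices set
system is positive. -/
theorem edgeLP_nonempty_iff_pU_pos
    {V : Type*} [Fintype V] [DecidableEq V]
    (G : SimpleGraph V) [DecidableRel G.Adj]
    (hiso : ∀ v : V, ∃ u : V, G.Adj v u) :
    (∃ (x : Sym2 V → ℝ) (p : ℝ), (∀ e ∈ G.edgeFinset, 0 ≤ x e) ∧ 0 ≤ p ∧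
        (∀ v : V, (∑ e ∈ G.edgeFinset.filter (fun e => v ∈ e), x e) = p) ∧
        (∑ e ∈ G.edgeFinset, x e) = 1) ↔
      0 < pU Finset.univ (coveredSets G) := by
  rcases isEmpty_or_nonempty V with hV | ⟨⟨v₀⟩⟩
  · have hE : G.edgeFinset = ∅ := eq_empty_of_isEmpty _
    have hset : ¬ 0 < pU univ (coveredSets G) := by
      refine (?_ : pU univ (coveredSets G) = 0).not_gt
      have hM : coveredSets G = {∅} := by
        refine eq_singleton_iff_unique_mem.2 ⟨?_, fun S _ => eq_empty_of_isEmpty S⟩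
        exact mem_image.2 ⟨∅, by simp [mem_matchings], by simp⟩
      refine Real.sSup_of_not_bddAbove fun ⟨b, hb⟩ => ?_
      have := hb (a := b + 1) ⟨fun _ => 1, by simp, by simp [hM], fun a => isEmptyElim a⟩
      linarith
    refine iff_of_false ?_ hset
    rintro ⟨x, p, -, -, -, hsum⟩
    simp [hE] at hsum
  rw [pU_pos_iff ⟨v₀, mem_univ v₀⟩]
  constructor
  · rintro ⟨x, p, hx, hp, hxv, hsum⟩
    obtain ⟨y, hy, hysum, hyv⟩ := exists_vertexWeights_of_edgeWeights G x hx
    refine ⟨p, hp.lt_of_ne' ?_, y, hy, hysum.trans hsum, fun v _ => (hyv v).trans (hxv v)⟩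
    rintro rfl
    refine one_ne_zero (hsum.symm.trans (sum_eq_zero fun e he => ?_))
    obtain ⟨v, hv⟩ : ∃ v, v ∈ e := ⟨_, e.out_fst_mem⟩
    exact (sum_eq_zero_iff_of_nonneg fun f hf => hx f (mem_filter.1 hf).1).1 (hxv v) e
      (mem_filter.2 ⟨he, hv⟩)
  · rintro ⟨p, hp, y, hy, -, hyv⟩
    obtain ⟨x, hx, hxv⟩ := exists_edgeWeights_of_vertexWeights G y hy
    have hpos : 0 < ∑ e ∈ G.edgeFinset, x e := by
      refine hp.trans_le ?_
      rw [← hyv v₀ (mem_univ v₀), ← hxv v₀]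
      exact sum_le_sum_of_subset_of_nonneg (filter_subset _ _) fun e _ _ => hx e
    refine ⟨fun e => x e / ∑ f ∈ G.edgeFinset, x f, p / ∑ f ∈ G.edgeFinset, x f,
      fun e _ => div_nonneg (hx e) hpos.le, (div_pos hp hpos).le, fun v => ?_, ?_⟩
    · rw [← sum_div, hxv v, hyv v (mem_univ v)]
    · rw [← sum_div, div_self hpos.ne']
end

section
/- Let G = (V, E) be a finite simple graph with no isolated vertices, and consider the set system (V, V(M)) where V(M) is the family of vertex sets covered by matchings of G. If p_U(V, V(M)) > 0, then p_U(V, V(M)) ≥ 2/3. -/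
open Finset

/-- A fixed-point-free permutation of a finite type admits a colouring with three colours in which
every point differs in colour from its image. -/
theorem exists_three_coloring_of_perm {V : Type*} [Fintype V] [DecidableEq V]
    (σ : Equiv.Perm V) (hσ : ∀ v, σ v ≠ v) :
    ∃ c : V → Fin 3, ∀ v, c v ≠ c (σ v) := by
  suffices h : ∀ S : Finset V, ∃ c : V → Fin 3, ∀ v ∈ S, σ v ∈ S → c v ≠ c (σ v) by
    obtain ⟨c, hc⟩ := h univ
    exact ⟨c, fun v => hc v (mem_univ _) (mem_univ _)⟩
  intro S
  induction S using Finset.induction_on with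
  | empty => exact ⟨fun _ => 0, by simp⟩
  | insert a S ha ih =>
    obtain ⟨c, hc⟩ := ih
    have avoid_two : ∀ i j : Fin 3, ∃ k, k ≠ i ∧ k ≠ j := by decide
    obtain ⟨k, hk₁, hk₂⟩ := avoid_two (c (σ a)) (c (σ.symm a))
    refine ⟨Function.update c a k, fun v hv hσv => ?_⟩
    by_cases hva : v = a
    · subst hva
      rwa [Function.update_self, Function.update_of_ne (hσ v)]
    · by_cases hσva : σ v = a
      · have hv' : v = σ.symm a := by rw [← hσva, Equiv.symm_apply_apply]
        rw [hσva, Function.update_self, Function.update_of_ne hva, hv']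
        exact hk₂.symm
      · rw [Function.update_of_ne hva, Function.update_of_ne hσva]
        exact hc v (mem_of_mem_insert_of_ne hv hva) (mem_of_mem_insert_of_ne hσv hσva)

/-- Within a set covered by a matching, the neighbours of `A` are at least as many as the elements
of `A`. -/
theorem card_inter_le_card_neighbors_inter {V : Type*} [Fintype V] [DecidableEq V]
    (G : SimpleGraph V) [DecidableRel G.Adj] {S : Finset V} (hS : S ∈ coveredSets G)
    (A : Finset V) :
    #(A.filter (· ∈ S)) ≤ #((A.biUnion fun v => G.neighborFinset v).filter (· ∈ S)) := by
  obtain ⟨m, hm, rfl⟩ := mem_image.mp hS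
  obtain ⟨hmG, hdisj⟩ := mem_filter.mp hm
  rw [mem_powerset] at hmG
  have partner : ∀ v : V, ∃ w : V, (∃ e ∈ m, v ∈ e) → s(v, w) ∈ m := by
    intro v
    by_cases h : ∃ e ∈ m, v ∈ e
    · obtain ⟨e, he, w, rfl⟩ := h
      exact ⟨w, fun _ => he⟩
    · exact ⟨v, fun h' => (h h').elim⟩
  choose g hg using partner
  refine card_le_card_of_injOn g ?_ ?_
  · intro v hv
    simp only [coe_filter, mem_filter, mem_univ, true_and, Set.mem_ofPred_eq, mem_biUnion,
      SimpleGraph.mem_neighborFinset] at hv ⊢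
    have hvm := hg v hv.2
    exact ⟨⟨v, hv.1, by simpa using hmG hvm⟩, _, hvm, Sym2.mem_mk_right _ _⟩
  · intro v hv w hw hvw
    simp only [coe_filter, mem_filter, mem_univ, true_and, Set.mem_ofPred_eq] at hv hw
    have hvm := hg v hv.2
    have hwm := hg w hw.2
    rw [← hvw] at hwm
    have heq : s(v, g v) = s(w, g v) := by
      by_contra hne
      exact hdisj _ hvm _ hwm hne (g v) ⟨Sym2.mem_mk_right _ _, Sym2.mem_mk_right _ _⟩
    exact Sym2.congr_left.mp heq

/-- The total weight of sets containing a point, summed over the points of `B`, counts each set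
with multiplicity the number of its points in `B`. -/
theorem sum_sum_filter_mem_eq {α : Type*} [DecidableEq α] (M : Finset (Finset α))
    (x : Finset α → ℝ) (B : Finset α) :
    ∑ a ∈ B, ∑ m ∈ M.filter (fun m => a ∈ m), x m = ∑ m ∈ M, #(B.filter (· ∈ m)) * x m := by
  simp_rw [sum_filter]
  rw [sum_comm]
  refine sum_congr rfl fun m _ => ?_
  rw [← sum_filter, sum_const, nsmul_eq_mul]

/-- If matchings can cover all vertices with the same positive probability, then some permutation
moves every vertex to a neighbour. -/
theorem exists_perm_adj_of_uniform {V : Type*} [Fintype V] [DecidableEq V]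
    (G : SimpleGraph V) [DecidableRel G.Adj] {p : ℝ} (hp : 0 < p) (x : Finset V → ℝ)
    (hx : ∀ S ∈ coveredSets G, 0 ≤ x S)
    (hxp : ∀ v, ∑ S ∈ (coveredSets G).filter (fun S => v ∈ S), x S = p) :
    ∃ σ : Equiv.Perm V, ∀ v, G.Adj v (σ v) := by
  have hall : ∀ A : Finset V, #A ≤ #(A.biUnion fun v => G.neighborFinset v) := by
    intro A
    have count : ∀ B : Finset V, (#B : ℝ) * p = ∑ S ∈ coveredSets G, #(B.filter (· ∈ S)) * x S := by
      intro B
      rw [← sum_sum_filter_mem_eq, sum_congr rfl fun v _ => hxp v, sum_const, nsmul_eq_mul]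
    have hle : (#A : ℝ) * p ≤ #(A.biUnion fun v => G.neighborFinset v) * p := by
      rw [count, count]
      refine sum_le_sum fun S hS => mul_le_mul_of_nonneg_right ?_ (hx S hS)
      exact_mod_cast card_inter_le_card_neighbors_inter G hS A
    exact_mod_cast le_of_mul_le_mul_right hle hp
  obtain ⟨f, hf, hadj⟩ := (all_card_le_biUnion_card_iff_exists_injective _).mp hall
  exact ⟨Equiv.ofBijective f (Finite.injective_iff_bijective.mp hf), fun v => by
    simpa using hadj v⟩

/-- The vertices covered by the edges `s(v, σ v)` of one colour class of a proper colouring form a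
set covered by a matching. -/
theorem colorClass_mem_coveredSets {V : Type*} [Fintype V] [DecidableEq V]
    (G : SimpleGraph V) [DecidableRel G.Adj] {σ : Equiv.Perm V} (hσ : ∀ v, G.Adj v (σ v))
    {ι : Type*} [DecidableEq ι] {c : V → ι} (hc : ∀ v, c v ≠ c (σ v)) (i : ι) :
    univ.filter (fun v => c v = i ∨ c (σ.symm v) = i) ∈ coveredSets G := by
  refine mem_image.mpr ⟨(univ.filter (c · = i)).image (fun v => s(v, σ v)), ?_, ?_⟩
  · refine mem_filter.mpr ⟨mem_powerset.mpr ?_, ?_⟩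
    · intro e he
      obtain ⟨v, -, rfl⟩ := mem_image.mp he
      simpa using hσ v
    · intro e he f hf hef u hu
      obtain ⟨v, hv, rfl⟩ := mem_image.mp he
      obtain ⟨w, hw, rfl⟩ := mem_image.mp hf
      simp only [mem_filter, mem_univ, true_and] at hv hw
      simp only [Sym2.mem_iff] at hu
      have hvw : v ≠ w := fun h => hef (by rw [h])
      obtain ⟨rfl | rfl, h | h⟩ := hu
      · exact hvw h
      · exact hc w (by rw [← h, hv, hw])
      · exact hc v (by rw [h, hv, hw])
      · exact hvw (σ.injective h)
  · ext v
    simp only [mem_filter, mem_univ, true_and, mem_image, exists_exists_and_eq_and, Sym2.mem_iff]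
    constructor
    · rintro ⟨w, hw, rfl | rfl⟩
      · exact Or.inl hw
      · exact Or.inr (by simpa using hw)
    · rintro (h | h)
      · exact ⟨v, h, Or.inl rfl⟩
      · exact ⟨_, h, Or.inr (by simp)⟩

/-- For a graph `G` without isolated vertices, if the uniform fairness value of the
fair matching for vertices set system is positive, then it is at least `2/3`. -/
theorem pU_ge_two_thirds_of_pos
    {V : Type*} [Fintype V] [DecidableEq V]
    (G : SimpleGraph V) [DecidableRel G.Adj]
    (hiso : ∀ v : V, ∃ u : V, G.Adj v u)
    (hpos : 0 < pU Finset.univ (coveredSets G)) :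
    2 / 3 ≤ pU Finset.univ (coveredSets G) := by
  unfold pU at hpos ⊢
  refine le_csSup (by_contra fun h => hpos.ne' (Real.sSup_of_not_bddAbove h)) ?_
  obtain ⟨p, ⟨x, hx, -, hxp⟩, hp⟩ : ∃ p ∈ {p : ℝ | ∃ x : Finset V → ℝ,
      (∀ m ∈ coveredSets G, 0 ≤ x m) ∧ (∑ m ∈ coveredSets G, x m) = 1 ∧
      ∀ a ∈ univ, (∑ m ∈ (coveredSets G).filter (fun m => a ∈ m), x m) = p}, 0 < p := by
    by_contra! h
    exact hpos.not_ge (Real.sSup_nonpos h)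
  obtain ⟨σ, hσ⟩ := exists_perm_adj_of_uniform G hp x hx fun v => hxp v (mem_univ v)
  obtain ⟨c, hc⟩ := exists_three_coloring_of_perm σ fun v => (hσ v).ne'
  set T : Fin 3 → Finset V := fun i => univ.filter (fun v => c v = i ∨ c (σ.symm v) = i) with hT
  have hTmem : ∀ i, T i ∈ coveredSets G := colorClass_mem_coveredSets G hσ hc
  refine ⟨fun S => ∑ i, if T i = S then 1 / 3 else 0, fun S _ => ?_, ?_, fun v _ => ?_⟩
  · exact sum_nonneg fun i _ => by split_ifs <;> norm_num
  · rw [sum_comm]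
    simp [hTmem]
  · have two_of_three : ∀ i j : Fin 3, i ≠ j →
        #(univ.filter fun k : Fin 3 => i = k ∨ j = k) = 2 := by decide
    have hne : c v ≠ c (σ.symm v) := by simpa using (hc (σ.symm v)).symm
    have hcard : #(univ.filter fun k => v ∈ T k) = 2 := by
      simpa [hT] using two_of_three _ _ hne
    rw [sum_comm]
    simp only [sum_ite_eq, mem_filter, hTmem, true_and]
    rw [← sum_filter, sum_const, hcard]
    norm_num
end
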